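/- Let d ≥ 4, n ≥ 1, and u ∈ ℝ^d with u ≠ 0. Let μ_n be the probability measure on (ℝ^d)^n with density ∏_{j=1}^n p^d_{1/n}(x_j − x_{j−1}) (with x₀ = 0) with respect to Lebesgue measure, and let θ̃_{u,n} be the probability measure on (ℝ^d)^n with density q_{u,n}/m(u,d) with respect to μ_n, where q_{u,n}(x₁,…,x_n) = ∫_{Δ₂} p^d_{σ²(s,t)}(n ∑_{j=1}^n α_j(s,t)(x_j − x_{j−1}) − u) ds dt and m(u,d) = ∫_{Δ₂} p^d_{t−s}(u) ds dt. Then the relative entropy satisfies H(θ̃_{u,n} | μ_n) ≤ −log(2 m(u,d) (2π)^{d/2}) − (d/(2 m(u,d))) ∫_{Δ₂} log(σ²(s,t)) p^d_{t−s}(u) ds dt. -/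

import Mathlib

open MeasureTheory Real

/-- The `d`-dimensional Gaussian density with variance parameter `ε`. -/
noncomputable def gaussD (d : ℕ) (ε : ℝ) (z : EuclideanSpace ℝ (Fin d)) : ℝ :=
  (2 * Real.pi * ε) ^ (-(d : ℝ) / 2) * Real.exp (-‖z‖ ^ 2 / (2 * ε))

/-- The simplex `Δ₂ = {(s,t) ∈ [0,1]² : s < t}`. -/
def Delta2 : Set (ℝ × ℝ) := {p | 0 ≤ p.1 ∧ p.1 < p.2 ∧ p.2 ≤ 1}

/-- `α_j(s,t) = λ([s,t] ∩ [t_{j-1},t_j])` where `t_j = j/n`. -/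
noncomputable def alphaJ (n : ℕ) (s t : ℝ) (j : Fin n) : ℝ :=
  (volume (Set.Icc s t ∩ Set.Icc ((j : ℝ) / n) (((j : ℝ) + 1) / n))).toReal

/-- `σ²(s,t) = (t - s) - n ∑_j α_j(s,t)²`. -/
noncomputable def sigma2 (n : ℕ) (s t : ℝ) : ℝ :=
  (t - s) - n * ∑ j : Fin n, alphaJ n s t j ^ 2

/-- The increment `x_j - x_{j-1}`, with the convention `x₀ = 0`. -/
noncomputable def padDiff {n d : ℕ} (x : Fin n → EuclideanSpace ℝ (Fin d)) (j : Fin n) :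
    EuclideanSpace ℝ (Fin d) :=
  (Fin.cons 0 x : Fin (n + 1) → EuclideanSpace ℝ (Fin d)) j.succ -
    (Fin.cons 0 x : Fin (n + 1) → EuclideanSpace ℝ (Fin d)) j.castSucc

/-- The law `μ_n` of `(W(1/n),…,W(1))`: the measure on `(ℝ^d)^n` with density
`∏_j p^d_{1/n}(x_j - x_{j-1})` with respect to Lebesgue measure. -/
noncomputable def muN (d n : ℕ) : Measure (Fin n → EuclideanSpace ℝ (Fin d)) :=
  volume.withDensity fun x => ENNReal.ofReal (∏ j : Fin n, gaussD d (1 / n) (padDiff x j))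

/-- The density `q_{u,n}` of the finite-dimensional marginal `θ_{u,n}` with respect to `μ_n`. -/
noncomputable def qUN (d n : ℕ) (u : EuclideanSpace ℝ (Fin d))
    (x : Fin n → EuclideanSpace ℝ (Fin d)) : ℝ :=
  ∫ p in Delta2,
    gaussD d (sigma2 n p.1 p.2) ((n : ℝ) • ∑ j : Fin n, alphaJ n p.1 p.2 j • padDiff x j - u)

/-- `m(u,d) = ∫_{Δ₂} p^d_{t-s}(u) ds dt`, the total mass of `θ_{u,n}`. -/
noncomputable def mUD (d : ℕ) (u : EuclideanSpace ℝ (Fin d)) : ℝ :=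
  ∫ p in Delta2, gaussD d (p.2 - p.1) u

/-- The normalized measure `θ̃_{u,n}`, with density `q_{u,n}/m(u,d)` with respect to `μ_n`. -/
noncomputable def thetaTilde (d n : ℕ) (u : EuclideanSpace ℝ (Fin d)) :
    Measure (Fin n → EuclideanSpace ℝ (Fin d)) :=
  (muN d n).withDensity fun x => ENNReal.ofReal (qUN d n u x / mUD d u)

lemma integral_gaussD (d : ℕ) {ε : ℝ} (hε : 0 < ε) :
    ∫ z, gaussD d ε z = 1 := by
  unfold gaussD
  have h := GaussianFourier.integral_rexp_neg_mul_sq_norm (V := EuclideanSpace ℝ (Fin d))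
    (b := 1 / (2 * ε)) (by positivity)
  rw [integral_const_mul]
  have e : ∀ z : EuclideanSpace ℝ (Fin d), -‖z‖ ^ 2 / (2 * ε) = -(1 / (2 * ε)) * ‖z‖ ^ 2 := by
    intro z; ring
  simp only [e]
  rw [h, finrank_euclideanSpace_fin]
  have e2 : π / (1 / (2 * ε)) = 2 * π * ε := by field_simp
  rw [e2, ← Real.rpow_add (by positivity), neg_div, neg_add_cancel, Real.rpow_zero]

lemma gaussD_nonneg (d : ℕ) {ε : ℝ} (hε : 0 ≤ ε) (z : EuclideanSpace ℝ (Fin d)) :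
    0 ≤ gaussD d ε z := by
  unfold gaussD; positivity

lemma gaussD_pos (d : ℕ) {ε : ℝ} (hε : 0 < ε) (z : EuclideanSpace ℝ (Fin d)) :
    0 < gaussD d ε z := by
  unfold gaussD; positivity

@[fun_prop]
lemma measurable_gaussD_comp {α : Type*} [MeasurableSpace α] (d : ℕ) {f : α → ℝ}
    {g : α → EuclideanSpace ℝ (Fin d)} (hf : Measurable f) (hg : Measurable g) :
    Measurable fun a => gaussD d (f a) (g a) := by
  unfold gaussD
  fun_prop

lemma lintegral_gaussD (d : ℕ) {ε : ℝ} (hε : 0 < ε) :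
    ∫⁻ z, ENNReal.ofReal (gaussD d ε z) = 1 := by
  have h := integral_gaussD d hε
  rw [← ofReal_integral_eq_lintegral_ofReal, h, ENNReal.ofReal_one]
  · by_contra hc
    rw [integral_undef hc] at h
    exact zero_ne_one h
  · exact Filter.Eventually.of_forall fun z => gaussD_nonneg d hε.le z

/-- Completing the square in a product of two Gaussian densities. -/
lemma gaussD_mul_gaussD (d : ℕ) {a b : ℝ} (ha : 0 < a) (hb : 0 < b) (c : ℝ)
    (y w : EuclideanSpace ℝ (Fin d)) :
    gaussD d a y * gaussD d b (c • y + w) =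
      gaussD d (a * b / (b + a * c ^ 2)) (y + (a * c / (b + a * c ^ 2)) • w) *
        gaussD d (b + a * c ^ 2) w := by
  have hs : 0 < b + a * c ^ 2 := by positivity
  unfold gaussD
  rw [mul_mul_mul_comm, mul_mul_mul_comm (_ ^ _) (rexp _) (_ ^ _) (rexp (-‖w‖ ^ 2 / _)), ← Real.exp_add, ← Real.exp_add,
    ← Real.mul_rpow (by positivity) (by positivity),
    ← Real.mul_rpow (by positivity) (by positivity)]
  congr 2
  · field_simp
  · rw [norm_add_sq_real, norm_add_sq_real, norm_smul, norm_smul, real_inner_smul_left,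
      real_inner_smul_right, mul_pow, mul_pow, Real.norm_eq_abs, Real.norm_eq_abs, sq_abs, sq_abs]
    field_simp
    ring

lemma lintegral_gaussD_mul_gaussD (d : ℕ) {a b : ℝ} (ha : 0 < a) (hb : 0 < b) (c : ℝ)
    (w : EuclideanSpace ℝ (Fin d)) :
    ∫⁻ y, ENNReal.ofReal (gaussD d a y) * ENNReal.ofReal (gaussD d b (c • y + w)) =
      ENNReal.ofReal (gaussD d (b + a * c ^ 2) w) := by
  have hs : 0 < b + a * c ^ 2 := by positivity
  have hr : 0 < a * b / (b + a * c ^ 2) := by positivity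
  simp_rw [← ENNReal.ofReal_mul (gaussD_nonneg d ha.le _), gaussD_mul_gaussD d ha hb,
    ENNReal.ofReal_mul (gaussD_nonneg d hr.le _)]
  rw [lintegral_mul_const _ (by fun_prop),
    lintegral_add_right_eq_self (fun y => ENNReal.ofReal (gaussD d (a * b / (b + a * c ^ 2)) y)),
    lintegral_gaussD d hr, one_mul]

/-- Increments of the path `x` started at `x₀`. -/
noncomputable def increment {n d : ℕ} (x₀ : EuclideanSpace ℝ (Fin d))
    (x : Fin n → EuclideanSpace ℝ (Fin d)) (j : Fin n) : EuclideanSpace ℝ (Fin d) :=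
  (Fin.cons x₀ x : Fin (n + 1) → EuclideanSpace ℝ (Fin d)) j.succ -
    (Fin.cons x₀ x : Fin (n + 1) → EuclideanSpace ℝ (Fin d)) j.castSucc

@[fun_prop]
lemma measurable_increment {n d : ℕ} (x₀ : EuclideanSpace ℝ (Fin d)) (j : Fin n) :
    Measurable fun x : Fin n → EuclideanSpace ℝ (Fin d) => increment x₀ x j := by
  unfold increment
  refine Measurable.sub (by simp only [Fin.cons_succ]; fun_prop) ?_
  cases n with
  | zero => exact j.elim0
  | succ n =>
    refine Fin.cases ?_ (fun i => ?_) j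
    · simp only [Fin.castSucc_zero, Fin.cons_zero]; fun_prop
    · simp only [← Fin.succ_castSucc, Fin.cons_succ]; fun_prop

/-- The random walk with Gaussian steps of variance `a`, tested against a Gaussian density of a
linear combination of its increments. -/
lemma lintegral_prod_gaussD_increment (d : ℕ) {a : ℝ} (ha : 0 < a) (n : ℕ) :
    ∀ (c : Fin n → ℝ) {b : ℝ}, 0 < b → ∀ x₀ w : EuclideanSpace ℝ (Fin d),
    ∫⁻ x : Fin n → EuclideanSpace ℝ (Fin d),
        (∏ j, ENNReal.ofReal (gaussD d a (increment x₀ x j))) *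
          ENNReal.ofReal (gaussD d b (∑ j, c j • increment x₀ x j + w)) =
      ENNReal.ofReal (gaussD d (b + a * ∑ j, c j ^ 2) w) := by
  induction n with
  | zero =>
    intro c b hb x₀ w
    simp [volume_pi]
  | succ n ih =>
    intro c b hb x₀ w
    have hmp := (volume_preserving_piFinSuccAbove
      (fun _ : Fin (n + 1) => EuclideanSpace ℝ (Fin d)) 0).symm
    rw [← hmp.lintegral_comp_emb (MeasurableEquiv.measurableEmbedding _), Measure.volume_eq_prod,
      lintegral_prod]
    · have hcons : ∀ z : EuclideanSpace ℝ (Fin d) × (Fin n → EuclideanSpace ℝ (Fin d)),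
          (MeasurableEquiv.piFinSuccAbove (fun _ : Fin (n + 1) => EuclideanSpace ℝ (Fin d)) 0).symm z
            = Fin.cons z.1 z.2 := by
        intro z
        simp [MeasurableEquiv.piFinSuccAbove, Fin.insertNthEquiv, Fin.insertNth_zero']
      have h0 : ∀ (y : EuclideanSpace ℝ (Fin d)) (x : Fin n → EuclideanSpace ℝ (Fin d)),
          increment x₀ (Fin.cons y x : Fin (n + 1) → _) 0 = y - x₀ := by
        intro y x; simp [increment]
      have hs : ∀ (y : EuclideanSpace ℝ (Fin d)) (x : Fin n → EuclideanSpace ℝ (Fin d)) (j : Fin n),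
          increment x₀ (Fin.cons y x : Fin (n + 1) → _) j.succ = increment y x j := by
        intro y x j; simp only [increment, ← Fin.succ_castSucc, Fin.cons_succ]
      simp only [hcons, Fin.prod_univ_succ, Fin.sum_univ_succ, h0, hs, mul_assoc]
      have key : ∀ y : EuclideanSpace ℝ (Fin d),
          ∫⁻ x : Fin n → EuclideanSpace ℝ (Fin d), ENNReal.ofReal (gaussD d a (y - x₀)) *
            ((∏ j, ENNReal.ofReal (gaussD d a (increment y x j))) *
              ENNReal.ofReal (gaussD d b
                (c 0 • (y - x₀) + ∑ j : Fin n, c j.succ • increment y x j + w))) =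
          ENNReal.ofReal (gaussD d a (y - x₀)) * ENNReal.ofReal
            (gaussD d (b + a * ∑ j : Fin n, c j.succ ^ 2) (c 0 • (y - x₀) + w)) := by
        intro y
        rw [lintegral_const_mul' _ _ ENNReal.ofReal_ne_top,
          ← ih (fun j => c j.succ) hb y (c 0 • (y - x₀) + w)]
        simp only [add_assoc, add_left_comm (c 0 • (y - x₀))]
      simp only [key]
      have hb' : 0 < b + a * ∑ j : Fin n, c j.succ ^ 2 :=
        add_pos_of_pos_of_nonneg hb (mul_nonneg ha.le (Finset.sum_nonneg fun _ _ => sq_nonneg _))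
      rw [lintegral_sub_right_eq_self (fun y => ENNReal.ofReal (gaussD d a y) * ENNReal.ofReal
            (gaussD d (b + a * ∑ j : Fin n, c j.succ ^ 2) (c 0 • y + w))),
        lintegral_gaussD_mul_gaussD d ha hb']
      congr 2
      ring
    · refine Measurable.aemeasurable ?_
      refine Measurable.comp (g := fun x : Fin (n + 1) → EuclideanSpace ℝ (Fin d) =>
        (∏ j, ENNReal.ofReal (gaussD d a (increment x₀ x j))) *
          ENNReal.ofReal (gaussD d b (∑ j, c j • increment x₀ x j + w))) ?_
        (MeasurableEquiv.measurable _)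
      fun_prop

@[fun_prop]
lemma measurable_padDiff {n d : ℕ} (j : Fin n) :
    Measurable fun x : Fin n → EuclideanSpace ℝ (Fin d) => padDiff x j :=
  measurable_increment 0 j

lemma lintegral_muN_gaussD {d n : ℕ} (hn : 1 ≤ n) (c : Fin n → ℝ) {b : ℝ} (hb : 0 < b)
    (w : EuclideanSpace ℝ (Fin d)) :
    ∫⁻ x, ENNReal.ofReal (gaussD d b (∑ j, c j • padDiff x j + w)) ∂(muN d n) =
      ENNReal.ofReal (gaussD d (b + 1 / n * ∑ j, c j ^ 2) w) := by
  have hn' : (0 : ℝ) < 1 / n := by positivity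
  rw [muN, lintegral_withDensity_eq_lintegral_mul _ (by fun_prop) (by fun_prop),
    ← lintegral_prod_gaussD_increment d hn' n c hb 0 w]
  refine lintegral_congr fun x => ?_
  rw [Pi.mul_apply, ENNReal.ofReal_prod_of_nonneg fun j _ => gaussD_nonneg d hn'.le _]
  rfl

lemma isProbabilityMeasure_muN (d : ℕ) {n : ℕ} (hn : 1 ≤ n) :
    IsProbabilityMeasure (muN d n) := by
  have h := lintegral_muN_gaussD (d := d) hn 0 one_pos 0
  have h0 : ENNReal.ofReal (gaussD d 1 0) ≠ 0 := by
    simpa using gaussD_pos d one_pos 0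
  simp only [Pi.zero_apply, zero_smul, Finset.sum_const_zero, lintegral_const, ne_eq,
    OfNat.ofNat_ne_zero, not_false_eq_true, zero_pow, mul_zero, add_zero] at h
  exact ⟨(ENNReal.mul_eq_left h0 ENNReal.ofReal_ne_top).1 h⟩

lemma alphaJ_eq (n : ℕ) (s t : ℝ) (j : Fin n) :
    alphaJ n s t j = max (min t (((j : ℝ) + 1) / n) - max s ((j : ℝ) / n)) 0 := by
  rw [alphaJ, Set.Icc_inter_Icc, Real.volume_Icc, ENNReal.toReal_ofReal']

@[fun_prop]
lemma measurable_alphaJ (n : ℕ) (j : Fin n) :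
    Measurable fun p : ℝ × ℝ => alphaJ n p.1 p.2 j := by
  simp only [alphaJ_eq]
  fun_prop

@[fun_prop]
lemma measurable_sigma2 (n : ℕ) : Measurable fun p : ℝ × ℝ => sigma2 n p.1 p.2 := by
  unfold sigma2
  fun_prop

lemma alphaJ_nonneg (n : ℕ) (s t : ℝ) (j : Fin n) : 0 ≤ alphaJ n s t j :=
  ENNReal.toReal_nonneg

lemma mul_alphaJ_le_one (n : ℕ) (s t : ℝ) (j : Fin n) : n * alphaJ n s t j ≤ 1 := by
  have hn : (0 : ℝ) < n := by exact_mod_cast j.pos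
  rw [← le_div_iff₀' hn, alphaJ_eq]
  refine max_le ?_ (by positivity)
  have h1 := min_le_right t (((j : ℝ) + 1) / n)
  have h2 := le_max_right s ((j : ℝ) / n)
  have h3 : ((j : ℝ) + 1) / n - (j : ℝ) / n = 1 / n := by ring
  linarith

lemma sum_alphaJ {n : ℕ} (hn : 1 ≤ n) {s t : ℝ} (hst : (s, t) ∈ Delta2) :
    ∑ j : Fin n, alphaJ n s t j = t - s := by
  obtain ⟨h0, h1, h2⟩ := hst
  simp only at h0 h1 h2
  have hn' : (0 : ℝ) < n := by exact_mod_cast hn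
  have key : ∀ j : Fin n, alphaJ n s t j =
      max s (min t (((j : ℕ) + 1 : ℕ) / n)) - max s (min t ((j : ℕ) / n)) := by
    intro j
    rw [alphaJ_eq]
    have : (j : ℝ) / n ≤ ((j : ℝ) + 1) / n := by gcongr; linarith
    push_cast
    generalize (j : ℝ) / n = a at *
    generalize ((j : ℝ) + 1) / n = b at *
    grind
  rw [Finset.sum_congr rfl fun j _ => key j,
    Fin.sum_univ_eq_sum_range (fun j : ℕ => max s (min t (((j + 1 : ℕ) : ℝ) / n)) -
      max s (min t ((j : ℝ) / n))) n,
    Finset.sum_range_sub (fun j : ℕ => max s (min t ((j : ℝ) / n)))]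
  have e : (n : ℝ) / n = 1 := div_self hn'.ne'
  simp only [e, Nat.cast_zero, zero_div]
  grind

lemma sigma2_eq_sum {n : ℕ} (hn : 1 ≤ n) {s t : ℝ} (hst : (s, t) ∈ Delta2) :
    sigma2 n s t = ∑ j : Fin n, alphaJ n s t j * (1 - n * alphaJ n s t j) := by
  rw [sigma2, ← sum_alphaJ hn hst, Finset.mul_sum, ← Finset.sum_sub_distrib]
  exact Finset.sum_congr rfl fun j _ => by ring

lemma sigma2_le_one {n : ℕ} {s t : ℝ} (hst : (s, t) ∈ Delta2) : sigma2 n s t ≤ 1 := by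
  obtain ⟨h0, h1, h2⟩ := hst
  have : (0 : ℝ) ≤ n * ∑ j : Fin n, alphaJ n s t j ^ 2 := by positivity
  simp only at h0 h1 h2
  rw [sigma2]
  linarith

lemma le_sigma2 {n : ℕ} (hn : 1 ≤ n) {s t : ℝ} (hst : (s, t) ∈ Delta2) (j : Fin n)
    (hj : (j : ℝ) < n * s) (hj' : n * s < j + 1) :
    (t - s) * (j + 1 - n * s) * (n * s - j) / n ≤ sigma2 n s t := by
  have hn' : (1 : ℝ) ≤ n := by exact_mod_cast hn
  have hn0 : (0 : ℝ) < n := by linarith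
  rw [sigma2_eq_sum hn hst]
  refine le_trans ?_ (Finset.single_le_sum (f := fun j => alphaJ n s t j *
    (1 - n * alphaJ n s t j)) (fun i _ => mul_nonneg (alphaJ_nonneg n s t i)
      (by linarith [mul_alphaJ_le_one n s t i])) (Finset.mem_univ j))
  obtain ⟨h0, h1, h2⟩ := hst
  simp only at h0 h1 h2
  have ha : (j : ℝ) / n ≤ s := by rw [div_le_iff₀ hn0]; linarith
  have hb : s ≤ ((j : ℝ) + 1) / n := by rw [le_div_iff₀ hn0]; linarith
  have e : alphaJ n s t j = min t (((j : ℝ) + 1) / n) - s := by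
    rw [alphaJ_eq]
    grind
  have e2 : ((j : ℝ) + 1) / n - s = (j + 1 - n * s) / n := by field_simp
  have hlow : (t - s) * ((j + 1 - n * s) / n) ≤ alphaJ n s t j := by
    have hq : 0 ≤ (j + 1 - n * s) / n := by rw [← e2]; linarith
    have hq1 : (j + 1 - n * s) / n ≤ 1 := by rw [div_le_one hn0]; linarith
    rw [e, ← min_sub_sub_right, e2]
    refine le_min ?_ ?_
    · nlinarith
    · nlinarith
  have hup : n * s - j ≤ 1 - n * alphaJ n s t j := by
    have : alphaJ n s t j ≤ (j + 1 - n * s) / n := by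
      rw [e, ← e2]; linarith [min_le_right t (((j : ℝ) + 1) / n)]
    rw [le_div_iff₀ hn0] at this
    linarith
  calc (t - s) * (j + 1 - n * s) * (n * s - j) / n
      = (t - s) * ((j + 1 - n * s) / n) * (n * s - j) := by ring
    _ ≤ _ := mul_le_mul hlow hup (by linarith) (alphaJ_nonneg n s t j)

lemma exists_fin_lt_mul_lt {n : ℕ} {s : ℝ} (h0 : 0 ≤ s) (h1 : s < 1)
    (hs : ∀ k : ℕ, (n : ℝ) * s ≠ k) : ∃ j : Fin n, (j : ℝ) < n * s ∧ n * s < j + 1 := by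
  have hn : (0 : ℝ) < n := by
    rcases Nat.eq_zero_or_pos n with rfl | h
    · exact absurd (by simp) (hs 0)
    · exact_mod_cast h
  refine ⟨⟨⌊n * s⌋₊, (Nat.floor_lt (by positivity)).2 (by nlinarith)⟩,
    lt_of_le_of_ne (Nat.floor_le (by positivity)) (hs _).symm, Nat.lt_floor_add_one _⟩

lemma sigma2_pos {n : ℕ} (hn : 1 ≤ n) {s t : ℝ} (hst : (s, t) ∈ Delta2)
    (hs : ∀ k : ℕ, (n : ℝ) * s ≠ k) : 0 < sigma2 n s t := by
  obtain ⟨j, hj, hj'⟩ := exists_fin_lt_mul_lt hst.1 (hst.2.1.trans_le hst.2.2) hs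
  refine lt_of_lt_of_le ?_ (le_sigma2 hn hst j hj hj')
  have := hst.2.1
  simp only at this
  have hn' : (0 : ℝ) < n := by exact_mod_cast hn
  exact div_pos (mul_pos (mul_pos (by linarith) (by linarith)) (by linarith)) hn'

lemma abs_log_sigma2_le {n : ℕ} (hn : 1 ≤ n) {s t : ℝ} (hst : (s, t) ∈ Delta2)
    (hs : ∀ k : ℕ, (n : ℝ) * s ≠ k) :
    |log (sigma2 n s t)| ≤
      |log (t - s)| + (log n + 2 * ∑ k ∈ Finset.range (n + 1), |log (n * s - k)|) := by
  obtain ⟨j, hj, hj'⟩ := exists_fin_lt_mul_lt hst.1 (hst.2.1.trans_le hst.2.2) hs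
  have hpos := sigma2_pos hn hst hs
  have hn' : (0 : ℝ) < n := by exact_mod_cast hn
  have hts : 0 < t - s := sub_pos.2 hst.2.1
  have ha : (0 : ℝ) < j + 1 - n * s := by linarith
  have hb : (0 : ℝ) < n * s - j := by linarith
  have hlog := log_le_log (by positivity) (le_sigma2 hn hst j hj hj')
  rw [log_div (by positivity) hn'.ne', log_mul (by positivity) hb.ne',
    log_mul hts.ne' ha.ne'] at hlog
  rw [abs_of_nonpos (log_nonpos hpos.le (sigma2_le_one hst))]
  have h1 : |log (n * s - (j : ℕ))| ≤ ∑ k ∈ Finset.range (n + 1), |log (n * s - k)| :=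
    Finset.single_le_sum (f := fun k : ℕ => |log (n * s - k)|) (fun _ _ => abs_nonneg _)
      (Finset.mem_range.2 (by omega))
  have h2 : |log (n * s - ((j : ℕ) + 1 : ℕ))| ≤ ∑ k ∈ Finset.range (n + 1), |log (n * s - k)| :=
    Finset.single_le_sum (f := fun k : ℕ => |log (n * s - k)|) (fun _ _ => abs_nonneg _)
      (Finset.mem_range.2 (by omega))
  rw [← log_neg_eq_log] at h2
  have e : -(n * s - (((j : ℕ) + 1 : ℕ) : ℝ)) = j + 1 - n * s := by push_cast; ring
  rw [e] at h2
  linarith [neg_abs_le (log (t - s)), neg_abs_le (log (j + 1 - n * s)),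
    neg_abs_le (log (n * s - (j : ℕ)))]

lemma measurableSet_Delta2 : MeasurableSet Delta2 :=
  (measurableSet_le measurable_const measurable_fst).inter
    ((measurableSet_lt measurable_fst measurable_snd).inter
      (measurableSet_le measurable_snd measurable_const))

lemma volume_Delta2_le : volume Delta2 ≤ ENNReal.ofReal (1 / 2) := by
  rw [Measure.volume_eq_prod, Measure.prod_apply measurableSet_Delta2]
  have h : ∀ s : ℝ, volume (Prod.mk s ⁻¹' Delta2) ≤
      (Set.Icc (0 : ℝ) 1).indicator (fun s => ENNReal.ofReal (1 - s)) s := by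
    intro s
    by_cases hs : s ∈ Set.Icc (0 : ℝ) 1
    · rw [Set.indicator_of_mem hs, ← Real.volume_Ioc]
      exact measure_mono fun t ht => ⟨ht.2.1, ht.2.2⟩
    · have : Prod.mk s ⁻¹' Delta2 = ∅ :=
        Set.eq_empty_of_forall_notMem fun t ht => hs ⟨ht.1, (ht.2.1.trans_le ht.2.2).le⟩
      simp [this]
  refine (lintegral_mono h).trans ?_
  rw [lintegral_indicator measurableSet_Icc, ← ofReal_integral_eq_lintegral_ofReal,
    integral_Icc_eq_integral_Ioc, ← intervalIntegral.integral_of_le zero_le_one]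
  · rw [intervalIntegral.integral_sub intervalIntegrable_const intervalIntegral.intervalIntegrable_id,
      intervalIntegral.integral_const, integral_id]
    norm_num
  · exact (continuous_const.sub continuous_id).continuousOn.integrableOn_Icc
  · exact (ae_restrict_iff' measurableSet_Icc).2
      (Filter.Eventually.of_forall fun s hs => sub_nonneg.2 hs.2)

lemma ae_forall_mul_fst_ne {n : ℕ} (hn : 1 ≤ n) :
    ∀ᵐ p : ℝ × ℝ, ∀ k : ℕ, (n : ℝ) * p.1 ≠ k := by
  have hn' : (n : ℝ) ≠ 0 := by exact_mod_cast (by omega : n ≠ 0)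
  refine ae_all_iff.2 fun k => ?_
  have h : ∀ᵐ s : ℝ, (n : ℝ) * s ≠ k := by
    filter_upwards [Measure.ae_ne volume ((k : ℝ) / n)] with s hs h
    exact hs (by rw [← h]; field_simp)
  exact Measure.quasiMeasurePreserving_fst.ae h

/-- Away from `u = 0` the heat kernel is at most linear in time. -/
lemma exists_gaussD_le_mul (d : ℕ) {u : EuclideanSpace ℝ (Fin d)} (hu : u ≠ 0) :
    ∃ C, 0 ≤ C ∧ ∀ r, 0 < r → r ≤ 1 → gaussD d r u ≤ C * r := by
  set v := ‖u‖ ^ 2 / 2 with hv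
  have hv0 : 0 < v := by have := norm_pos_iff.2 hu; positivity
  refine ⟨(d + 1).factorial / v ^ (d + 1), by positivity, fun r hr hr1 => ?_⟩
  have h1 : (2 * π * r) ^ (-(d : ℝ) / 2) ≤ (r ^ d)⁻¹ := by
    calc (2 * π * r) ^ (-(d : ℝ) / 2) ≤ r ^ (-(d : ℝ) / 2) :=
          rpow_le_rpow_of_nonpos hr (by nlinarith [pi_gt_three])
            (by have : (0 : ℝ) ≤ d := by positivity
                linarith)
      _ ≤ r ^ (-(d : ℝ)) := rpow_le_rpow_of_exponent_ge hr hr1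
            (by have : (0 : ℝ) ≤ d := by positivity
                linarith)
      _ = (r ^ d)⁻¹ := by rw [rpow_neg hr.le, rpow_natCast]
  have h2 : rexp (-‖u‖ ^ 2 / (2 * r)) ≤ (d + 1).factorial / (v / r) ^ (d + 1) := by
    have e : -‖u‖ ^ 2 / (2 * r) = -(v / r) := by rw [hv]; field_simp
    have h3 := pow_div_factorial_le_exp (v / r) (by positivity) (d + 1)
    rw [e, exp_neg, ← inv_div ((v / r) ^ (d + 1))]
    exact inv_anti₀ (by positivity) h3
  calc gaussD d r u ≤ (r ^ d)⁻¹ * ((d + 1).factorial / (v / r) ^ (d + 1)) := by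
        unfold gaussD
        exact mul_le_mul h1 h2 (exp_pos _).le (by positivity)
    _ = _ := by rw [div_pow, pow_succ r d]; field_simp

instance isFiniteMeasure_restrict_Delta2 : IsFiniteMeasure (volume.restrict Delta2) :=
  ⟨by simpa using volume_Delta2_le.trans_lt ENNReal.ofReal_lt_top⟩

lemma integrableOn_log_mul_sub (n : ℕ) (hn : 1 ≤ n) (k : ℝ) :
    IntegrableOn (fun s : ℝ => log (n * s - k)) (Set.Icc 0 1) := by
  have hn' : (n : ℝ) ≠ 0 := by exact_mod_cast (by omega : n ≠ 0)
  rw [integrableOn_Icc_iff_integrableOn_Ioc, ← intervalIntegrable_iff_integrableOn_Ioc_of_le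
    zero_le_one]
  have h := ((intervalIntegral.intervalIntegrable_log' (a := 0 - k) (b := n - k)).comp_sub_right
    k).comp_mul_left (c := (n : ℝ))
  simpa [hn'] using h

lemma integrableOn_gaussD (d : ℕ) {u : EuclideanSpace ℝ (Fin d)} (hu : u ≠ 0) :
    IntegrableOn (fun p : ℝ × ℝ => gaussD d (p.2 - p.1) u) Delta2 := by
  obtain ⟨C, hC, h⟩ := exists_gaussD_le_mul d hu
  refine Integrable.of_bound (C := C) (Measurable.aestronglyMeasurable (by fun_prop)) ?_
  filter_upwards [ae_restrict_mem measurableSet_Delta2] with p ⟨h0, h1, h2⟩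
  rw [Real.norm_of_nonneg (gaussD_nonneg d (by linarith) u)]
  exact (h _ (by linarith) (by linarith)).trans (mul_le_of_le_one_right hC (by linarith))

lemma integrableOn_log_sigma2_mul_gaussD (d : ℕ) {n : ℕ} (hn : 1 ≤ n)
    {u : EuclideanSpace ℝ (Fin d)} (hu : u ≠ 0) :
    IntegrableOn (fun p : ℝ × ℝ => log (sigma2 n p.1 p.2) * gaussD d (p.2 - p.1) u) Delta2 := by
  obtain ⟨C, hC, h⟩ := exists_gaussD_le_mul d hu
  have hg : IntegrableOn (fun p : ℝ × ℝ => C * (1 + (log n +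
      2 * ∑ k ∈ Finset.range (n + 1), |log (n * p.1 - k)|))) (Set.Icc 0 1 ×ˢ Set.Icc 0 1) := by
    have h1 : IntegrableOn (fun s : ℝ => C * (1 + (log n +
        2 * ∑ k ∈ Finset.range (n + 1), |log (n * s - k)|))) (Set.Icc 0 1) := by
      have hs : Integrable (fun s : ℝ => ∑ k ∈ Finset.range (n + 1), |log (n * s - k)|)
          (volume.restrict (Set.Icc 0 1)) :=
        integrable_finsetSum _ fun k _ => (integrableOn_log_mul_sub n hn k).abs
      exact (((integrable_const _).add ((integrable_const _).add (hs.const_mul 2))).const_mul C)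
    rw [IntegrableOn, Measure.volume_eq_prod, ← Measure.prod_restrict]
    exact h1.comp_fst _
  refine (hg.mono_set (s := Delta2) fun p hp => ⟨⟨hp.1, (hp.2.1.trans_le hp.2.2).le⟩,
    ⟨(hp.1.trans_lt hp.2.1).le, hp.2.2⟩⟩).mono' (Measurable.aestronglyMeasurable (by fun_prop)) ?_
  filter_upwards [ae_restrict_mem measurableSet_Delta2,
    ae_restrict_of_ae (ae_forall_mul_fst_ne hn)] with p hp hs
  have hr : 0 < p.2 - p.1 := sub_pos.2 hp.2.1
  have hr1 : p.2 - p.1 ≤ 1 := by linarith [hp.1, hp.2.2]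
  have hgn := gaussD_nonneg d hr.le u
  have hgle := h _ hr hr1
  rw [norm_mul, Real.norm_of_nonneg hgn, Real.norm_eq_abs]
  set A := log n + 2 * ∑ k ∈ Finset.range (n + 1), |log (n * p.1 - k)|
  have hA0 : 0 ≤ A := by
    have : 0 ≤ log (n : ℝ) := log_natCast_nonneg n
    positivity
  have hl : |log (p.2 - p.1)| * (p.2 - p.1) ≤ 1 := by
    have := abs_log_mul_self_lt _ hr hr1
    rw [abs_mul, abs_of_pos hr] at this
    exact this.le
  calc |log (sigma2 n p.1 p.2)| * gaussD d (p.2 - p.1) u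
      ≤ (|log (p.2 - p.1)| + A) * (C * (p.2 - p.1)) :=
        mul_le_mul (abs_log_sigma2_le hn hp hs) hgle hgn (by positivity)
    _ = C * (|log (p.2 - p.1)| * (p.2 - p.1) + A * (p.2 - p.1)) := by ring
    _ ≤ C * (1 + A) := by gcongr; exact mul_le_of_le_one_right hA0 hr1

/-- The integrand of `qUN` as a function of the path and of the pair of times. -/
noncomputable def qKernel (d n : ℕ) (u : EuclideanSpace ℝ (Fin d))
    (x : Fin n → EuclideanSpace ℝ (Fin d)) (p : ℝ × ℝ) : ℝ :=
  gaussD d (sigma2 n p.1 p.2) ((n : ℝ) • ∑ j : Fin n, alphaJ n p.1 p.2 j • padDiff x j - u)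

lemma measurable_qKernel (d n : ℕ) (u : EuclideanSpace ℝ (Fin d)) :
    Measurable fun z : (Fin n → EuclideanSpace ℝ (Fin d)) × (ℝ × ℝ) => qKernel d n u z.1 z.2 := by
  have hm' : ∀ j, Measurable fun z : (Fin n → EuclideanSpace ℝ (Fin d)) × (ℝ × ℝ) =>
      padDiff z.1 j := fun j => (measurable_padDiff j).comp measurable_fst
  have ha : ∀ j, Measurable fun z : (Fin n → EuclideanSpace ℝ (Fin d)) × (ℝ × ℝ) =>
      alphaJ n z.2.1 z.2.2 j := fun j => (measurable_alphaJ n j).comp measurable_snd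
  have hs : Measurable fun z : (Fin n → EuclideanSpace ℝ (Fin d)) × (ℝ × ℝ) =>
      sigma2 n z.2.1 z.2.2 := (measurable_sigma2 n).comp measurable_snd
  unfold qKernel
  fun_prop

lemma ae_Delta2_sigma2_pos {n : ℕ} (hn : 1 ≤ n) :
    ∀ᵐ p ∂(volume.restrict Delta2), p ∈ Delta2 ∧ 0 < sigma2 n p.1 p.2 := by
  filter_upwards [ae_restrict_mem measurableSet_Delta2,
    ae_restrict_of_ae (ae_forall_mul_fst_ne hn)] with p hp hs
  exact ⟨hp, sigma2_pos hn hp hs⟩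

lemma qKernel_nonneg {d n : ℕ} (u : EuclideanSpace ℝ (Fin d))
    (x : Fin n → EuclideanSpace ℝ (Fin d)) {p : ℝ × ℝ} (hp : 0 < sigma2 n p.1 p.2) :
    0 ≤ qKernel d n u x p :=
  gaussD_nonneg d hp.le _

lemma lintegral_qKernel {d n : ℕ} (hn : 1 ≤ n) (u : EuclideanSpace ℝ (Fin d)) {p : ℝ × ℝ}
    (hp : 0 < sigma2 n p.1 p.2) :
    ∫⁻ x, ENNReal.ofReal (qKernel d n u x p) ∂(muN d n) =
      ENNReal.ofReal (gaussD d (p.2 - p.1) u) := by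
  have hn' : (n : ℝ) ≠ 0 := by exact_mod_cast (by omega : n ≠ 0)
  have h := lintegral_muN_gaussD hn (fun j => n * alphaJ n p.1 p.2 j) hp (-u)
  have e : sigma2 n p.1 p.2 + 1 / n * ∑ j : Fin n, (n * alphaJ n p.1 p.2 j) ^ 2 = p.2 - p.1 := by
    simp only [mul_pow, ← Finset.mul_sum, sigma2]
    field_simp
    ring
  rw [e] at h
  simpa only [mul_smul, ← Finset.smul_sum, ← sub_eq_add_neg, qKernel, gaussD, norm_neg] using h

lemma integrable_qKernel {d n : ℕ} (hn : 1 ≤ n) (u : EuclideanSpace ℝ (Fin d)) {p : ℝ × ℝ}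
    (hp : 0 < sigma2 n p.1 p.2) : Integrable (fun x => qKernel d n u x p) (muN d n) := by
  refine ⟨((measurable_qKernel d n u).comp measurable_prodMk_right).aestronglyMeasurable, ?_⟩
  rw [hasFiniteIntegral_iff_ofReal
    (Filter.Eventually.of_forall fun x => qKernel_nonneg u x hp), lintegral_qKernel hn u hp]
  exact ENNReal.ofReal_lt_top

lemma integral_qKernel {d n : ℕ} (hn : 1 ≤ n) (u : EuclideanSpace ℝ (Fin d)) {p : ℝ × ℝ}
    (hp : p ∈ Delta2) (hp' : 0 < sigma2 n p.1 p.2) :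
    ∫ x, qKernel d n u x p ∂(muN d n) = gaussD d (p.2 - p.1) u := by
  rw [integral_eq_lintegral_of_nonneg_ae
    (Filter.Eventually.of_forall fun x => qKernel_nonneg u x hp')
    (integrable_qKernel hn u hp').1, lintegral_qKernel hn u hp',
    ENNReal.toReal_ofReal (gaussD_nonneg d (sub_pos.2 hp.2.1).le _)]

section Weighted

variable {d n : ℕ} {u : EuclideanSpace ℝ (Fin d)} {K : ℝ × ℝ → ℝ}

lemma integrable_mul_qKernel (hn : 1 ≤ n) (hK : Measurable K)
    (hKg : IntegrableOn (fun p => K p * gaussD d (p.2 - p.1) u) Delta2) :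
    Integrable (fun z : (Fin n → EuclideanSpace ℝ (Fin d)) × (ℝ × ℝ) =>
      K z.2 * qKernel d n u z.1 z.2) ((muN d n).prod (volume.restrict Delta2)) := by
  have := isProbabilityMeasure_muN d hn
  have hm : Measurable fun z : (Fin n → EuclideanSpace ℝ (Fin d)) × (ℝ × ℝ) =>
      K z.2 * qKernel d n u z.1 z.2 := (hK.comp measurable_snd).mul (measurable_qKernel d n u)
  rw [integrable_prod_iff' hm.aestronglyMeasurable]
  refine ⟨?_, hKg.norm.congr ?_⟩
  · filter_upwards [ae_Delta2_sigma2_pos hn] with p hp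
    exact (integrable_qKernel hn u hp.2).const_mul _
  · filter_upwards [ae_Delta2_sigma2_pos hn] with p hp
    have h : ∀ x, ‖K p * qKernel d n u x p‖ = ‖K p‖ * qKernel d n u x p := fun x => by
      rw [norm_mul, Real.norm_of_nonneg (qKernel_nonneg u x hp.2)]
    simp only [h]
    rw [integral_const_mul, integral_qKernel hn u hp.1 hp.2, norm_mul,
      Real.norm_of_nonneg (gaussD_nonneg d (sub_pos.2 hp.1.2.1).le u)]

lemma integral_integral_mul_qKernel (hn : 1 ≤ n) (hK : Measurable K)
    (hKg : IntegrableOn (fun p => K p * gaussD d (p.2 - p.1) u) Delta2) :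
    ∫ x, (∫ p in Delta2, K p * qKernel d n u x p) ∂(muN d n) =
      ∫ p in Delta2, K p * gaussD d (p.2 - p.1) u := by
  have := isProbabilityMeasure_muN d hn
  rw [integral_integral_swap (integrable_mul_qKernel hn hK hKg)]
  refine integral_congr_ae ?_
  filter_upwards [ae_Delta2_sigma2_pos hn] with p hp
  rw [integral_const_mul, integral_qKernel hn u hp.1 hp.2]

end Weighted

/-- The tangent-line inequality for the convex function `x ↦ x log x`. -/
lemma mul_log_add_sub_le_mul_log {a b : ℝ} (ha : 0 < a) (hb : 0 < b) :
    a * log b + a - b ≤ a * log a := by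
  have h := log_le_sub_one_of_pos (div_pos hb ha)
  rw [log_div hb.ne' ha.ne', le_sub_iff_add_le, le_div_iff₀ ha] at h
  linarith

/-- Jensen's inequality for `x ↦ x log x` over a measure of mass at most `1 / 2`. -/
lemma integral_mul_log_two_mul_integral_le {α : Type*} [MeasurableSpace α] {ν : Measure α}
    [IsFiniteMeasure ν] (hν : ν.real Set.univ ≤ 1 / 2) {f K : α → ℝ} (hf : Integrable f ν)
    (hKf : Integrable (fun a => K a * f a) ν) (hpos : ∀ᵐ a ∂ν, 0 < f a)
    (hK : ∀ᵐ a ∂ν, log (f a) ≤ K a) :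
    (∫ a, f a ∂ν) * log (2 * ∫ a, f a ∂ν) ≤ ∫ a, K a * f a ∂ν := by
  have hnn : 0 ≤ᵐ[ν] f := hpos.mono fun a ha => ha.le
  rcases (integral_nonneg_of_ae hnn).eq_or_lt with h0 | h0
  · rw [← h0, zero_mul]
    have hz := (integral_eq_zero_iff_of_nonneg_ae hnn hf).1 h0.symm
    refine (integral_eq_zero_of_ae ?_).ge
    filter_upwards [hz] with a ha
    simp [ha]
  · set Q := ∫ a, f a ∂ν
    have hle : ∫ a, (f a * log (2 * Q) + f a - 2 * Q) ∂ν ≤ ∫ a, K a * f a ∂ν := by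
      refine integral_mono_ae (((hf.mul_const _).add hf).sub (integrable_const _)) hKf ?_
      filter_upwards [hpos, hK] with a ha hKa
      refine (mul_log_add_sub_le_mul_log ha (by positivity)).trans ?_
      rw [mul_comm]
      exact mul_le_mul_of_nonneg_right hKa ha.le
    have e : ∫ a, (f a * log (2 * Q) + f a - 2 * Q) ∂ν =
        Q * log (2 * Q) + Q - ν.real Set.univ * (2 * Q) := by
      have hadd : Integrable (fun a => f a * log (2 * Q) + f a) ν := (hf.mul_const _).add hf
      rw [integral_sub hadd (integrable_const _), integral_add (hf.mul_const _) hf, integral_mul_const, integral_const, smul_eq_mul]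
    rw [e] at hle
    nlinarith

lemma log_qKernel_le {d n : ℕ} (u : EuclideanSpace ℝ (Fin d))
    (x : Fin n → EuclideanSpace ℝ (Fin d)) {p : ℝ × ℝ} (hp : 0 < sigma2 n p.1 p.2) :
    log (qKernel d n u x p) ≤ -(d / 2) * log (2 * π) - d / 2 * log (sigma2 n p.1 p.2) := by
  rw [qKernel, gaussD, log_mul (by positivity) (by positivity), log_exp,
    log_rpow (by positivity), log_mul (by positivity) hp.ne', neg_div (2 * sigma2 n p.1 p.2)]
  have : 0 ≤ ‖(n : ℝ) • ∑ j : Fin n, alphaJ n p.1 p.2 j • padDiff x j - u‖ ^ 2 /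
    (2 * sigma2 n p.1 p.2) := by positivity
  linarith

lemma measurable_qUN (d n : ℕ) (u : EuclideanSpace ℝ (Fin d)) : Measurable (qUN d n u) :=
  ((measurable_qKernel d n u).stronglyMeasurable.integral_prod_right'
    (ν := volume.restrict Delta2)).measurable

lemma qUN_nonneg {d n : ℕ} (hn : 1 ≤ n) (u : EuclideanSpace ℝ (Fin d))
    (x : Fin n → EuclideanSpace ℝ (Fin d)) : 0 ≤ qUN d n u x :=
  integral_nonneg_of_ae ((ae_Delta2_sigma2_pos hn).mono fun _ hp => qKernel_nonneg u x hp.2)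

theorem stmt16 (d n : ℕ) (hd : 4 ≤ d) (hn : 1 ≤ n)
    (u : EuclideanSpace ℝ (Fin d)) (hu : u ≠ 0) :
    (∫ x, Real.log (qUN d n u x / mUD d u) ∂(thetaTilde d n u))
      ≤ -Real.log (2 * mUD d u * (2 * Real.pi) ^ ((d : ℝ) / 2))
        - (d / (2 * mUD d u)) *
          ∫ p in Delta2, Real.log (sigma2 n p.1 p.2) * gaussD d (p.2 - p.1) u := by
  have := isProbabilityMeasure_muN d hn
  have hm0 : 0 ≤ mUD d u := setIntegral_nonneg measurableSet_Delta2 fun p hp =>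
    gaussD_nonneg d (sub_pos.2 hp.2.1).le u
  rcases hm0.eq_or_lt with hm | hm
  · simp [← hm]
  have hg := integrableOn_gaussD d hu
  have hlg := integrableOn_log_sigma2_mul_gaussD d hn hu
  set K : ℝ × ℝ → ℝ := fun p => -(d / 2) * log (2 * π) - d / 2 * log (sigma2 n p.1 p.2)
  have hKm : Measurable K := by fun_prop
  have hKeq : (fun p => K p * gaussD d (p.2 - p.1) u) = fun p =>
      -(d / 2) * log (2 * π) * gaussD d (p.2 - p.1) u -
        d / 2 * (log (sigma2 n p.1 p.2) * gaussD d (p.2 - p.1) u) := by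
    funext p; ring
  have hKg : IntegrableOn (fun p => K p * gaussD d (p.2 - p.1) u) Delta2 := by
    rw [hKeq]
    exact (hg.const_mul _).sub (hlg.const_mul _)
  have hone : IntegrableOn (fun p : ℝ × ℝ => (1 : ℝ) * gaussD d (p.2 - p.1) u) Delta2 := by
    simpa using hg
  have hprod := integrable_mul_qKernel hn hKm hKg
  have hprod1 := integrable_mul_qKernel (K := fun _ => 1) hn measurable_const hone
  have hq : Integrable (qUN d n u) (muN d n) := by
    simpa only [one_mul, qKernel] using! hprod1.integral_prod_left
  have hqm : ∫ x, qUN d n u x ∂(muN d n) = mUD d u := by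
    simpa only [one_mul, qKernel] using!
      integral_integral_mul_qKernel (K := fun _ => 1) hn measurable_const hone
  have hF := hprod.integral_prod_left
  have hFm := integral_integral_mul_qKernel hn hKm hKg
  have hν : (volume.restrict Delta2).real Set.univ ≤ 1 / 2 := by
    rw [measureReal_restrict_apply_univ]
    exact ENNReal.toReal_le_of_le_ofReal (by norm_num) volume_Delta2_le
  have hjensen : ∀ᵐ x ∂(muN d n), qUN d n u x * log (2 * qUN d n u x) ≤
      ∫ p in Delta2, K p * qKernel d n u x p := by
    filter_upwards [hprod.prod_right_ae, hprod1.prod_right_ae] with x hx hx1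
    simp only [one_mul] at hx1
    refine integral_mul_log_two_mul_integral_le hν hx1 hx ?_ ?_
    · exact (ae_Delta2_sigma2_pos hn).mono fun p hp => gaussD_pos d hp.2 _
    · exact (ae_Delta2_sigma2_pos hn).mono fun p hp => log_qKernel_le u x hp.2
  have hlow : ∀ x, qUN d n u x - 1 / 2 ≤ qUN d n u x * log (2 * qUN d n u x) := by
    intro x
    rcases (qUN_nonneg hn u x).eq_or_lt with h | h
    · rw [← h]; norm_num
    · have := mul_log_add_sub_le_mul_log (a := 2 * qUN d n u x) (by positivity) one_pos
      rw [log_one] at this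
      linarith
  have hqlog : Integrable (fun x => qUN d n u x * log (2 * qUN d n u x)) (muN d n) := by
    have hqmeas := measurable_qUN d n u
    refine (hF.norm.add (hq.sub (integrable_const (1 / 2))).norm).mono'
      (Measurable.aestronglyMeasurable (by fun_prop)) ?_
    filter_upwards [hjensen] with x hx
    rw [Real.norm_eq_abs, abs_le]
    simp only [Pi.add_apply, Pi.sub_apply, Real.norm_eq_abs]
    constructor
    · linarith [hlow x, neg_abs_le (qUN d n u x - 1 / 2),
        abs_nonneg (∫ p in Delta2, K p * qKernel d n u x p)]
    · linarith [le_abs_self (∫ p in Delta2, K p * qKernel d n u x p),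
        abs_nonneg (qUN d n u x - 1 / 2)]
  have hmain := (integral_mono_ae hqlog hF hjensen).trans_eq hFm
  have hL : ∫ x, log (qUN d n u x / mUD d u) ∂(thetaTilde d n u) =
      (∫ x, qUN d n u x * log (2 * qUN d n u x) ∂(muN d n)) / mUD d u - log (2 * mUD d u) := by
    rw [thetaTilde, integral_withDensity_eq_integral_toReal_smul
      ((measurable_qUN d n u).div_const _).ennreal_ofReal
      (Filter.Eventually.of_forall fun _ => ENNReal.ofReal_lt_top)]
    have e : ∀ x, (ENNReal.ofReal (qUN d n u x / mUD d u)).toReal •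
        log (qUN d n u x / mUD d u) = (qUN d n u x * log (2 * qUN d n u x)) / mUD d u -
          qUN d n u x * (log (2 * mUD d u) / mUD d u) := by
      intro x
      rw [ENNReal.toReal_ofReal (div_nonneg (qUN_nonneg hn u x) hm.le), smul_eq_mul]
      rcases (qUN_nonneg hn u x).eq_or_lt with h | h
      · simp [← h]
      · rw [log_div h.ne' hm.ne', log_mul two_ne_zero h.ne', log_mul two_ne_zero hm.ne']
        ring
    simp only [e]
    rw [integral_sub (hqlog.div_const _) (hq.mul_const _), integral_div, integral_mul_const, hqm,
      mul_div_cancel₀ _ hm.ne']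
  have hR : ∫ p in Delta2, K p * gaussD d (p.2 - p.1) u =
      -(d / 2) * log (2 * π) * mUD d u -
        d / 2 * ∫ p in Delta2, log (sigma2 n p.1 p.2) * gaussD d (p.2 - p.1) u := by
    rw [hKeq, integral_sub (hg.const_mul _) (hlg.const_mul _), integral_const_mul,
      integral_const_mul, mUD]
  rw [hL, log_mul (mul_pos two_pos hm).ne' (by positivity), log_rpow (by positivity)]
  rw [hR] at hmain
  have hdiv := div_le_div_of_nonneg_right hmain hm.le
  refine (sub_le_sub_right hdiv _).trans_eq ?_
  field_simp
  ring
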